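/- arXiv:1910.14463 — 3 statements merged into one kernel-verified Lean document; each statement's English description precedes it below -/
import Mathlib

section
/- Semigroup property of the delayed thermostat: let ρ₋₁ < ρ₁ be real thresholds. For every continuous input X : [0,∞) → ℝ, every initial output w ∈ {−1,1}, and all t, τ ≥ 0, one has h_ρ[X;w](t+τ) = h_ρ[X(·+t); h_ρ[X;w](t)](τ), where X(·+t) denotes the time-shifted input s ↦ X(s+t). -/
open Filter Set Topology

/-- The set of times `τ ∈ [0, t)` at which the input `X` is strictly beyond one of the
thresholds `ρm < ρp`. -/
def crossSet (ρm ρp : ℝ) (X : ℝ → ℝ) (t : ℝ) : Set ℝ :=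
  {τ | 0 ≤ τ ∧ τ < t ∧ (X τ < ρm ∨ ρp < X τ)}

/-- `W` is the output of the delayed thermostat with thresholds `ρm < ρp`, input `X`
and initial output `w`:  `W` is left-continuous, takes values in `{-1, 1}`, equals `1`
(resp. `-1`) whenever the input is strictly above `ρp` (resp. strictly below `ρm`), and,
when the input lies in the band `[ρm, ρp]` at time `t ≥ 0`, `W t` equals the left limit of
`W` at `τ_t = sup (crossSet ρm ρp X t)` if that set is nonempty, and equals `w` otherwise. -/
structure IsThermostat (ρm ρp : ℝ) (X : ℝ → ℝ) (w : ℝ) (W : ℝ → ℝ) : Prop where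
  leftCont : ∀ t : ℝ, 0 < t → Tendsto W (nhdsWithin t (Iio t)) (nhds (W t))
  values : ∀ t : ℝ, 0 ≤ t → W t = 1 ∨ W t = -1
  high : ∀ t : ℝ, 0 ≤ t → ρp < X t → W t = 1
  low : ∀ t : ℝ, 0 ≤ t → X t < ρm → W t = -1
  band : ∀ t : ℝ, 0 ≤ t → ρm ≤ X t → X t ≤ ρp →
    ((crossSet ρm ρp X t).Nonempty →
      Tendsto W (nhdsWithin (sSup (crossSet ρm ρp X t)) (Iio (sSup (crossSet ρm ρp X t))))
        (nhds (W t))) ∧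
    (¬ (crossSet ρm ρp X t).Nonempty → W t = w)

/-- Being strictly beyond a threshold is an open condition, so `crossSet` has no maximum. -/
lemma exists_gt_mem_crossSet {ρm ρp : ℝ} {X : ℝ → ℝ} (hX : ContinuousOn X (Ici 0))
    {t s : ℝ} (hs : s ∈ crossSet ρm ρp X t) : ∃ u ∈ crossSet ρm ρp X t, s < u := by
  obtain ⟨h0, hst, hout⟩ := hs
  have hcont : Tendsto X (𝓝[>] s) (𝓝 (X s)) :=
    (hX s h0).mono_left (nhdsWithin_mono s fun u (hu : s < u) => h0.trans hu.le)
  have hbeyond : ∀ᶠ u in 𝓝[>] s, X u < ρm ∨ ρp < X u :=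
    hcont.eventually ((isOpen_Iio.union isOpen_Ioi).mem_nhds hout)
  obtain ⟨u, hu, hsu, hut⟩ := (hbeyond.and (Ioo_mem_nhdsGT hst)).exists
  exact ⟨u, ⟨h0.trans hsu.le, hut, hu⟩, hsu⟩

lemma bddAbove_crossSet (ρm ρp : ℝ) (X : ℝ → ℝ) (t : ℝ) : BddAbove (crossSet ρm ρp X t) :=
  ⟨t, fun _ h => h.2.1.le⟩

/-- Threshold crossings accumulate at their supremum strictly from the left. -/
lemma frequently_mem_crossSet {ρm ρp : ℝ} {X : ℝ → ℝ} (hX : ContinuousOn X (Ici 0)) {t : ℝ}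
    (hne : (crossSet ρm ρp X t).Nonempty) :
    ∃ᶠ u in 𝓝[<] sSup (crossSet ρm ρp X t), u ∈ crossSet ρm ρp X t := by
  have hlub := isLUB_csSup hne (bddAbove_crossSet ρm ρp X t)
  have hnot : sSup (crossSet ρm ρp X t) ∉ crossSet ρm ρp X t := fun hmem =>
    let ⟨_, hu, hlt⟩ := exists_gt_mem_crossSet hX hmem
    (hlub.1 hu).not_gt hlt
  have hfreq := hlub.frequently_mem hne
  rw [← Iio_insert, nhdsWithin_insert, frequently_sup] at hfreq
  exact hfreq.resolve_left (by simpa using hnot)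

/-- The last crossing time is compatible with time shifts, once the shifted input crosses. -/
lemma sSup_crossSet_add {ρm ρp : ℝ} {X : ℝ → ℝ} {t τ : ℝ} (ht : 0 ≤ t)
    (hne : (crossSet ρm ρp (fun s => X (s + t)) τ).Nonempty) :
    (crossSet ρm ρp X (t + τ)).Nonempty ∧ sSup (crossSet ρm ρp X (t + τ)) =
      sSup (crossSet ρm ρp (fun s => X (s + t)) τ) + t := by
  have hshift : ∀ u ∈ crossSet ρm ρp (fun s => X (s + t)) τ, u + t ∈ crossSet ρm ρp X (t + τ) :=
    fun u hu => ⟨add_nonneg hu.1 ht, by linarith [hu.2.1], hu.2.2⟩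
  have hne' : (crossSet ρm ρp X (t + τ)).Nonempty :=
    let ⟨u, hu⟩ := hne
    ⟨u + t, hshift u hu⟩
  have hbdd := bddAbove_crossSet ρm ρp (fun s => X (s + t)) τ
  refine ⟨hne', le_antisymm (csSup_le hne' fun v hv => ?_) ?_⟩
  · rcases le_total t v with htv | hvt
    · have hmem : v - t ∈ crossSet ρm ρp (fun s => X (s + t)) τ :=
        ⟨sub_nonneg.2 htv, by linarith [hv.2.1], by simpa using hv.2.2⟩
      linarith [le_csSup hbdd hmem]
    · obtain ⟨u, hu⟩ := hne
      linarith [le_csSup hbdd hu, hu.1]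
  · rw [← le_sub_iff_add_le]
    exact csSup_le hne fun u hu =>
      le_sub_iff_add_le.2 (le_csSup (bddAbove_crossSet ρm ρp X (t + τ)) (hshift u hu))

/-- **Semigroup property of the delayed thermostat**: for every continuous input `X`,
initial output `w ∈ {-1,1}` and `t, τ ≥ 0`,
`h_ρ[X; w] (t + τ) = h_ρ[X(· + t); h_ρ[X; w] t] τ`. -/
theorem thermostat_semigroup
    (ρm ρp : ℝ) (hρ : ρm < ρp)
    (X : ℝ → ℝ) (hX : ContinuousOn X (Ici 0))
    (w : ℝ) (hw : w = 1 ∨ w = -1)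
    (W : ℝ → ℝ) (hW : IsThermostat ρm ρp X w W)
    (t τ : ℝ) (ht : 0 ≤ t) (hτ : 0 ≤ τ)
    (W' : ℝ → ℝ) (hW' : IsThermostat ρm ρp (fun s => X (s + t)) (W t) W') :
    W (t + τ) = W' τ := by
  have hout : ∀ s, 0 ≤ s → (X (s + t) < ρm ∨ ρp < X (s + t)) → W (s + t) = W' s := by
    rintro s hs (h | h)
    · rw [hW.low _ (add_nonneg hs ht) h, hW'.low s hs h]
    · rw [hW.high _ (add_nonneg hs ht) h, hW'.high s hs h]
  by_cases hb : X (τ + t) < ρm ∨ ρp < X (τ + t)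
  · rw [add_comm]
    exact hout τ hτ hb
  push Not at hb
  have hband := hW.band (t + τ) (add_nonneg ht hτ) (by rw [add_comm]; exact hb.1)
    (by rw [add_comm]; exact hb.2)
  have hband' := hW'.band τ hτ hb.1 hb.2
  by_cases hne : (crossSet ρm ρp (fun s => X (s + t)) τ).Nonempty
  · obtain ⟨hne₀, hsup⟩ := sSup_crossSet_add ht hne
    have hlim := hband.1 hne₀
    rw [hsup] at hlim
    have hX' : ContinuousOn (fun s => X (s + t)) (Ici 0) :=
      hX.comp (by fun_prop) fun s (hs : 0 ≤ s) => add_nonneg hs ht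
    set σ := sSup (crossSet ρm ρp (fun s => X (s + t)) τ)
    have hshift : Tendsto (fun u => u + t) (𝓝[<] σ) (𝓝[<] (σ + t)) :=
      ((continuous_add_const t).continuousWithinAt).tendsto_nhdsWithin
        fun u (hu : u < σ) => by simpa using hu
    have hdiff := (hlim.comp hshift).sub (hband'.1 hne)
    have hzero := isClosed_singleton.mem_of_frequently_of_tendsto
      ((frequently_mem_crossSet hX' hne).mono fun u hu =>
        mem_singleton_iff.2 (sub_eq_zero.2 (hout u hu.1 hu.2.2))) hdiff
    exact sub_eq_zero.1 hzero
  · rw [hband'.2 hne]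
    have hin : ∀ v, t ≤ v → v < t + τ → ¬ (X v < ρm ∨ ρp < X v) := fun v htv hv h =>
      hne ⟨v - t, sub_nonneg.2 htv, by linarith, by simpa using h⟩
    have hcross : crossSet ρm ρp X (t + τ) = crossSet ρm ρp X t := by
      ext v
      exact ⟨fun hv => ⟨hv.1, not_le.1 fun h => hin v h hv.2.1 hv.2.2, hv.2.2⟩,
        fun hv => ⟨hv.1, by linarith [hv.2.1], hv.2.2⟩⟩
    have hbt : ¬ (X t < ρm ∨ ρp < X t) := by
      rcases hτ.eq_or_lt with rfl | hpos
      · simpa using hb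
      · exact hin t le_rfl (by linarith)
    push Not at hbt
    have hband₀ := hW.band t ht hbt.1 hbt.2
    rw [hcross] at hband
    by_cases hc : (crossSet ρm ρp X t).Nonempty
    · exact tendsto_nhds_unique (hband.1 hc) (hband₀.1 hc)
    · rw [hband.2 hc, hband₀.2 hc]
end

section
/- Quantitative absence of Zeno behavior: let ρ₋₁ < ρ₁, let w ∈ {−1,1}, and let X : [0,∞) → ℝ be Lipschitz continuous with constant M > 0 with (X(0),w) ∈ O₋₁ ∪ O₁. Call t > 0 a switching instant of W = h_ρ[X;w] if lim_{s→t⁺} W(s) ≠ W(t). Then any two distinct switching instants t₁ < t₂ of W satisfy t₂ − t₁ ≥ (ρ₁ − ρ₋₁)/M; consequently, for every T > 0 the number of switching instants of W in [0,T] is at most 1 + M·T/(ρ₁ − ρ₋₁). -/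
open Filter Set Topology

/-- The set `O₋₁ ∪ O₁ = ((-∞, ρp] × {-1}) ∪ ([ρm, ∞) × {1})`. -/
def OSet (ρm ρp : ℝ) : Set (ℝ × ℝ) :=
  (Iic ρp ×ˢ ({-1} : Set ℝ)) ∪ (Ici ρm ×ˢ ({1} : Set ℝ))

/-- `t > 0` is a switching instant of `W` when the right limit of `W` at `t` exists and
differs from `W t`. -/
def IsSwitchInstant (W : ℝ → ℝ) (t : ℝ) : Prop :=
  0 < t ∧ ∃ c : ℝ, Tendsto W (nhdsWithin t (Ioi t)) (nhds c) ∧ c ≠ W t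

lemma crossSet_neg (ρm ρp : ℝ) (X : ℝ → ℝ) (t : ℝ) :
    crossSet (-ρp) (-ρm) (-X) t = crossSet ρm ρp X t := by
  ext τ
  simp [crossSet, or_comm]

/-- Reflecting the input and the thresholds reflects the output. -/
lemma IsThermostat.neg {ρm ρp w : ℝ} {X W : ℝ → ℝ} (h : IsThermostat ρm ρp X w W) :
    IsThermostat (-ρp) (-ρm) (-X) (-w) (-W) where
  leftCont t ht := (h.leftCont t ht).neg
  values t ht := by
    rcases h.values t ht with h | h <;> simp [h]
  high t ht hx := by
    have := h.low t ht (by simpa using hx)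
    simp [this]
  low t ht hx := by
    have := h.high t ht (by simpa using hx)
    simp [this]
  band t ht h1 h2 := by
    rw [crossSet_neg]
    obtain ⟨ha, hb⟩ := h.band t ht (by simpa using h2) (by simpa using h1)
    exact ⟨fun hn => (ha hn).neg, fun hn => by simp [hb hn]⟩

lemma IsSwitchInstant.neg {W : ℝ → ℝ} {t : ℝ} (h : IsSwitchInstant W t) :
    IsSwitchInstant (-W) t := by
  obtain ⟨h0, c, hc, hne⟩ := h
  exact ⟨h0, -c, hc.neg, by simpa using hne⟩

/-- The output does not change while the input stays in the band. -/
lemma IsThermostat.eq_of_mem_band {ρm ρp w : ℝ} {X W : ℝ → ℝ}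
    (h : IsThermostat ρm ρp X w W) {s t : ℝ} (hs : 0 ≤ s) (hst : s ≤ t)
    (hband : ∀ u ∈ Icc s t, X u ∈ Icc ρm ρp) : W s = W t := by
  have heq : crossSet ρm ρp X s = crossSet ρm ρp X t := by
    ext τ
    refine ⟨fun ⟨h1, h2, h3⟩ => ⟨h1, h2.trans_le hst, h3⟩, fun ⟨h1, h2, h3⟩ => ⟨h1, ?_, h3⟩⟩
    by_contra! hτ
    obtain ⟨h4, h5⟩ := hband τ ⟨hτ, h2.le⟩
    rcases h3 with h3 | h3 <;> linarith
  obtain ⟨h1, h2⟩ := hband s ⟨le_rfl, hst⟩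
  obtain ⟨h3, h4⟩ := hband t ⟨hst, le_rfl⟩
  have hbs := h.band s hs h1 h2
  have hbt := h.band t (hs.trans hst) h3 h4
  rw [heq] at hbs
  by_cases hne : (crossSet ρm ρp X t).Nonempty
  · exact tendsto_nhds_unique (hbs.1 hne) (hbt.1 hne)
  · rw [hbs.2 hne, hbt.2 hne]

lemma IsThermostat.eventually_eq_one {ρm ρp w : ℝ} {X W : ℝ → ℝ}
    (h : IsThermostat ρm ρp X w W) {t : ℝ} (ht : IsSwitchInstant W t) (hWt : W t = -1) :
    ∀ᶠ s in 𝓝[>] t, W s = 1 := by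
  obtain ⟨h0, c, hc, hne⟩ := ht
  rw [hWt] at hne
  filter_upwards [hc.eventually_ne hne, self_mem_nhdsWithin] with s hs hst
  exact (h.values s (h0.le.trans (le_of_lt hst))).resolve_right hs

/-- At an upward switching instant the input equals the upper threshold. -/
lemma IsThermostat.input_eq_of_switch_up {ρm ρp w : ℝ} {X W : ℝ → ℝ}
    (h : IsThermostat ρm ρp X w W) (hX : ContinuousOn X (Ici 0)) {t : ℝ}
    (ht : IsSwitchInstant W t) (hWt : W t = -1) : X t = ρp := by
  have h0 := ht.1
  have hcont : ContinuousAt X t := hX.continuousAt (Ici_mem_nhds h0)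
  have hup : X t ≤ ρp := by
    by_contra! hlt
    linarith [h.high t h0.le hlt]
  by_contra hne
  have hlt : X t < ρp := lt_of_le_of_ne hup hne
  have hev : ∀ᶠ s in 𝓝[>] t, W s = 1 ∧ X s < ρp :=
    (h.eventually_eq_one ht hWt).and ((hcont.eventually_lt_const hlt).filter_mono inf_le_left)
  obtain ⟨b, hb, hsub⟩ := mem_nhdsGT_iff_exists_Ioo_subset.1 hev
  have hlow : ∀ s ∈ Ioo t b, ρm ≤ X s := by
    intro s hs
    by_contra! hl
    linarith [h.low s (h0.le.trans hs.1.le) hl, (hsub hs).1]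
  have hlowt : ρm ≤ X t := by
    refine ge_of_tendsto (hcont.tendsto.mono_left (nhdsWithin_le_nhds (s := Ioi t))) ?_
    filter_upwards [Ioo_mem_nhdsGT hb] with s hs using hlow s hs
  obtain ⟨s, hs⟩ := nonempty_Ioo.2 (show t < b from hb)
  have heq := h.eq_of_mem_band h0.le hs.1.le (fun u hu => by
    rcases hu.1.eq_or_lt with rfl | htu
    · exact ⟨hlowt, hup⟩
    · have hmem : u ∈ Ioo t b := ⟨htu, hu.2.trans_lt hs.2⟩
      exact ⟨hlow u hmem, (hsub hmem).2.le⟩)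
  linarith [(hsub hs).1]

/-- At a downward switching instant the input equals the lower threshold. -/
lemma IsThermostat.input_eq_of_switch_down {ρm ρp w : ℝ} {X W : ℝ → ℝ}
    (h : IsThermostat ρm ρp X w W) (hX : ContinuousOn X (Ici 0)) {t : ℝ}
    (ht : IsSwitchInstant W t) (hWt : W t = 1) : X t = ρm := by
  simpa using h.neg.input_eq_of_switch_up hX.neg ht.neg (by simp [hWt])

/-- Between two upward switching instants the input reaches the lower threshold. -/
lemma IsThermostat.exists_le_of_switch_up {ρm ρp w : ℝ} {X W : ℝ → ℝ}
    (h : IsThermostat ρm ρp X w W) (hρ : ρm < ρp) (hX : ContinuousOn X (Ici 0)) {t₁ t₂ : ℝ}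
    (ht₁ : IsSwitchInstant W t₁) (ht₂ : IsSwitchInstant W t₂) (hlt : t₁ < t₂)
    (hW₁ : W t₁ = -1) (hW₂ : W t₂ = -1) : ∃ u ∈ Ioo t₁ t₂, X u ≤ ρm := by
  have h0 := ht₁.1
  have hX₂ := h.input_eq_of_switch_up hX ht₂ hW₂
  by_contra! hlow
  set C := crossSet ρm ρp X t₂
  by_cases hcross : ∃ c ∈ Ioo t₁ t₂, ρp < X c
  · obtain ⟨c, hc, hXc⟩ := hcross
    have hbdd : BddAbove C := ⟨t₂, fun τ hτ => hτ.2.1.le⟩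
    have hcC : c ∈ C := ⟨h0.le.trans hc.1.le, hc.2, Or.inr hXc⟩
    have hcτ : c ≤ sSup C := le_csSup hbdd hcC
    have hhigh : ∀ τ ∈ C, t₁ < τ → ρp < X τ := fun τ hτ hlt' =>
      hτ.2.2.resolve_left (hlow τ ⟨hlt', hτ.2.1⟩).not_gt
    have hnot : sSup C ∉ C := by
      intro hmem
      have hpos : 0 < sSup C := h0.trans (hc.1.trans_le hcτ)
      have hcont : ContinuousAt X (sSup C) := hX.continuousAt (Ici_mem_nhds hpos)
      have hev : ∀ᶠ s in 𝓝[>] (sSup C), ρp < X s :=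
        (hcont.eventually_const_lt (hhigh _ hmem (hc.1.trans_le hcτ))).filter_mono inf_le_left
      obtain ⟨s, hs, hsτ⟩ := (hev.and (Ioo_mem_nhdsGT hmem.2.1)).exists
      have := le_csSup hbdd (show s ∈ C from ⟨hpos.le.trans hsτ.1.le, hsτ.2, Or.inr hs⟩)
      exact absurd hsτ.1 this.not_gt
    have hlim := (h.band t₂ ht₂.1.le (hX₂ ▸ hρ.le) hX₂.le).1 ⟨c, hcC⟩
    rw [hW₂] at hlim
    have hev : ∀ᶠ s in 𝓝[<] (sSup C), W s ≠ 1 := hlim.eventually_ne (by norm_num)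
    obtain ⟨l, hl, hsub⟩ := mem_nhdsLT_iff_exists_Ioo_subset.1 hev
    obtain ⟨d, hdC, hd⟩ := exists_lt_of_lt_csSup ⟨c, hcC⟩
      (max_lt (show l < sSup C from hl) (hc.1.trans_le hcτ))
    have hdτ : d < sSup C :=
      lt_of_le_of_ne (le_csSup hbdd hdC) (fun heq => hnot (heq ▸ hdC))
    exact hsub ⟨(le_max_left _ _).trans_lt hd, hdτ⟩
      (h.high d hdC.1 (hhigh d hdC ((le_max_right _ _).trans_lt hd)))
  · push Not at hcross
    obtain ⟨s, hs, hst⟩ :=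
      ((h.eventually_eq_one ht₁ hW₁).and (Ioo_mem_nhdsGT hlt)).exists
    have heq := h.eq_of_mem_band (h0.le.trans hst.1.le) hst.2.le (fun u hu => by
      rcases hu.2.eq_or_lt with rfl | hut
      · exact ⟨hX₂ ▸ hρ.le, hX₂.le⟩
      · have hmem : u ∈ Ioo t₁ t₂ := ⟨hst.1.trans_le hu.1, hut⟩
        exact ⟨(hlow u hmem).le, hcross u hmem⟩)
    linarith

lemma continuousOn_of_abs_sub_le {M : ℝ} {X : ℝ → ℝ} (hM : 0 < M)
    (hX : ∀ s t : ℝ, 0 ≤ s → 0 ≤ t → |X s - X t| ≤ M * |s - t|) : ContinuousOn X (Ici 0) := by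
  refine (LipschitzOnWith.of_dist_le_mul (K := M.toNNReal) fun s hs t ht => ?_).continuousOn
  simpa [Real.dist_eq, hM.le] using hX s t hs ht

/-- Two upward switching instants are at least `(ρp - ρm) / M` apart. -/
lemma IsThermostat.gap_of_switch_up {ρm ρp w M : ℝ} {X W : ℝ → ℝ}
    (h : IsThermostat ρm ρp X w W) (hρ : ρm < ρp) (hM : 0 < M)
    (hX : ∀ s t : ℝ, 0 ≤ s → 0 ≤ t → |X s - X t| ≤ M * |s - t|) {t₁ t₂ : ℝ}
    (ht₁ : IsSwitchInstant W t₁) (ht₂ : IsSwitchInstant W t₂) (hlt : t₁ < t₂)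
    (hW₁ : W t₁ = -1) (hW₂ : W t₂ = -1) : ρp - ρm ≤ M * (t₂ - t₁) := by
  have hcont := continuousOn_of_abs_sub_le hM hX
  obtain ⟨u, hu, hXu⟩ := h.exists_le_of_switch_up hρ hcont ht₁ ht₂ hlt hW₁ hW₂
  have hX₁ := h.input_eq_of_switch_up hcont ht₁ hW₁
  have hlip := hX u t₁ (ht₁.1.le.trans hu.1.le) ht₁.1.le
  rw [abs_of_pos (sub_pos.2 hu.1)] at hlip
  have hmono : M * (u - t₁) ≤ M * (t₂ - t₁) := by
    gcongr
    exact hu.2.le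
  linarith [neg_abs_le (X u - X t₁)]

/-- Distinct switching instants are at least `(ρp - ρm) / M` apart. -/
lemma IsThermostat.switch_gap {ρm ρp w M : ℝ} {X W : ℝ → ℝ}
    (h : IsThermostat ρm ρp X w W) (hρ : ρm < ρp) (hM : 0 < M)
    (hX : ∀ s t : ℝ, 0 ≤ s → 0 ≤ t → |X s - X t| ≤ M * |s - t|) {t₁ t₂ : ℝ}
    (ht₁ : IsSwitchInstant W t₁) (ht₂ : IsSwitchInstant W t₂) (hlt : t₁ < t₂) :
    (ρp - ρm) / M ≤ t₂ - t₁ := by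
  rw [div_le_iff₀' hM]
  have hcont := continuousOn_of_abs_sub_le hM hX
  have hlip := hX t₂ t₁ ht₂.1.le ht₁.1.le
  rw [abs_of_pos (sub_pos.2 hlt)] at hlip
  rcases h.values t₁ ht₁.1.le with hW₁ | hW₁ <;> rcases h.values t₂ ht₂.1.le with hW₂ | hW₂
  · have := h.neg.gap_of_switch_up (neg_lt_neg hρ) hM
      (fun s t hs ht => by simpa [neg_add_eq_sub, abs_sub_comm] using hX s t hs ht)
      ht₁.neg ht₂.neg hlt (by simp [hW₁]) (by simp [hW₂])
    linarith
  · rw [h.input_eq_of_switch_down hcont ht₁ hW₁,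
      h.input_eq_of_switch_up hcont ht₂ hW₂] at hlip
    exact (le_abs_self _).trans hlip
  · rw [h.input_eq_of_switch_up hcont ht₁ hW₁,
      h.input_eq_of_switch_down hcont ht₂ hW₂, abs_sub_comm] at hlip
    exact (le_abs_self _).trans hlip
  · exact h.gap_of_switch_up hρ hM hX ht₁ ht₂ hlt hW₁ hW₂

/-- A `δ`-separated subset of `[0, T]` has at most `1 + T / δ` elements. -/
lemma finite_and_ncard_le_of_separated {S : Set ℝ} {δ T : ℝ} (hδ : 0 < δ) (hT : 0 ≤ T)
    (hS : S ⊆ Icc 0 T) (hsep : ∀ s ∈ S, ∀ t ∈ S, s < t → δ ≤ t - s) :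
    S.Finite ∧ (S.ncard : ℝ) ≤ 1 + T / δ := by
  have hfloor : ∀ s ∈ S, ∀ t ∈ S, s < t → ⌊s / δ⌋₊ < ⌊t / δ⌋₊ := by
    intro s hs t ht hst
    have hle : s / δ + 1 ≤ t / δ := by
      rw [div_add_one hδ.ne']
      gcongr
      linarith [hsep s hs t ht hst]
    have := Nat.floor_le_floor hle
    rw [Nat.floor_add_one (div_nonneg (hS hs).1 hδ.le)] at this
    omega
  have hinj : InjOn (fun t : ℝ => ⌊t / δ⌋₊) S := by
    intro s hs t ht heq
    rcases lt_trichotomy s t with hst | hst | hst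
    · exact absurd heq (hfloor s hs t ht hst).ne
    · exact hst
    · exact absurd heq (hfloor t ht s hs hst).ne'
  have hmaps : MapsTo (fun t : ℝ => ⌊t / δ⌋₊) S (Finset.range (⌊T / δ⌋₊ + 1) : Finset ℕ) := by
    intro t ht
    simp only [Finset.coe_range, mem_Iio, Nat.lt_add_one_iff]
    gcongr
    exact (hS ht).2
  refine ⟨Finite.of_injOn hmaps hinj (Finset.finite_toSet _), ?_⟩
  have hcard := ncard_le_ncard_of_injOn _ hmaps hinj (Finset.finite_toSet _)
  rw [ncard_coe_finset, Finset.card_range] at hcard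
  have hcard' : (S.ncard : ℝ) ≤ (⌊T / δ⌋₊ : ℝ) + 1 := by exact_mod_cast hcard
  linarith [Nat.floor_le (div_nonneg hT hδ.le)]

/-- **Quantitative absence of Zeno behavior**: if the input `X` is `M`-Lipschitz on
`[0, ∞)`, then any two distinct switching instants of the thermostat output `W` are at
least `(ρp - ρm)/M` apart; consequently, for every `T > 0` the number of switching
instants in `[0, T]` is at most `1 + M T / (ρp - ρm)`. -/
theorem thermostat_no_zeno
    (ρm ρp : ℝ) (hρ : ρm < ρp)
    (M : ℝ) (hM : 0 < M)
    (X : ℝ → ℝ) (hX : ∀ s t : ℝ, 0 ≤ s → 0 ≤ t → |X s - X t| ≤ M * |s - t|)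
    (w : ℝ) (hw : w = 1 ∨ w = -1) (h0 : (X 0, w) ∈ OSet ρm ρp)
    (W : ℝ → ℝ) (hW : IsThermostat ρm ρp X w W) :
    (∀ t₁ t₂ : ℝ, IsSwitchInstant W t₁ → IsSwitchInstant W t₂ → t₁ < t₂ →
      (ρp - ρm) / M ≤ t₂ - t₁) ∧
    (∀ T : ℝ, 0 < T →
      {t | t ∈ Icc (0 : ℝ) T ∧ IsSwitchInstant W t}.Finite ∧
      ({t | t ∈ Icc (0 : ℝ) T ∧ IsSwitchInstant W t}.ncard : ℝ) ≤ 1 + M * T / (ρp - ρm)) := by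
  refine ⟨fun t₁ t₂ ht₁ ht₂ hlt => hW.switch_gap hρ hM hX ht₁ ht₂ hlt, fun T hT => ?_⟩
  have hcount := finite_and_ncard_le_of_separated
    (S := {t | t ∈ Icc (0 : ℝ) T ∧ IsSwitchInstant W t})
    (div_pos (sub_pos.2 hρ) hM) hT.le (fun t ht => ht.1)
    (fun s hs t ht hst => hW.switch_gap hρ hM hX hs.2 ht.2 hst)
  rwa [div_div_eq_mul_div, mul_comm T M] at hcount
end

section
/- The operator T₃ is a contraction: under the Main Assumptions and the controllability condition, setting h = min{(ρ₁ − ρ₋₁)/M, (η₁ − η₋₁)/M} > 0, for all u¹, u² ∈ C one has ‖T₃[u¹] − T₃[u²]‖_∞ ≤ e^{−λh} ‖u¹ − u²‖_∞, where ‖·‖_∞ is the sup norm over ⋃₍w,z₎ B̄₍w,z₎ × {(w,z)}. -/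
open Filter Set Topology MeasureTheory intervalIntegral
open scoped ENNReal

noncomputable section

/-- Euclidean space `ℝ^d`. -/
abbrev E (d : ℕ) := EuclideanSpace ℝ (Fin d)

/-- Measurable controls with values in the compact set `A`. -/
def Ctrl {d : ℕ} (A : Set (E d)) : Type :=
  {a : ℝ → E d // Measurable a ∧ ∀ t : ℝ, a t ∈ A}

/-- Non-anticipating map from controls with values in `B` to controls with values in `A`
(a non-anticipating strategy). -/
def NAStrategy {d e : ℕ} (B : Set (E d)) (A : Set (E e)) (γ : Ctrl B → Ctrl A) : Prop :=
  ∀ t : ℝ, 0 ≤ t → ∀ β₁ β₂ : Ctrl B,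
    (∀ᵐ s ∂(volume.restrict (Icc (0 : ℝ) t)), β₁.1 s = β₂.1 s) →
    (∀ᵐ s ∂(volume.restrict (Icc (0 : ℝ) t)), (γ β₁).1 s = (γ β₂).1 s)

/-- A non-anticipating tuning: a non-anticipating map from the set of controls with
values in `A` to itself. -/
def NATuning {d : ℕ} (A : Set (E d)) (T : Ctrl A → Ctrl A) : Prop :=
  NAStrategy A A T

/-- The data and standing ("Main") assumptions of the switching infinite-horizon
differential game: thresholds `ρ₋₁ < ρ₁` and `η₋₁ < η₁` of the two delayed thermostats,
compact control sets `A`, `B`, switching-dependent bounded Lipschitz dynamics `f`, `g`,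
a nonnegative bounded Lipschitz running cost `ℓ = ℓ₁ + ℓ₂` decoupled in the controls,
a positive discount factor, and the controllability condition at the switching
thresholds. -/
structure Setting (n m k l : ℕ) where
  /-- lower threshold `ρ₋₁` for player `X` -/
  ρm : ℝ
  /-- upper threshold `ρ₁` for player `X` -/
  ρp : ℝ
  /-- lower threshold `η₋₁` for player `Y` -/
  ηm : ℝ
  /-- upper threshold `η₁` for player `Y` -/
  ηp : ℝ
  hρ : ρm < ρp
  hη : ηm < ηp
  /-- control set of player `X` -/
  A : Set (E k)
  /-- control set of player `Y` -/
  B : Set (E l)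
  hA : IsCompact A
  hB : IsCompact B
  hAne : A.Nonempty
  hBne : B.Nonempty
  /-- dynamics of player `X` -/
  f : E (n + 1) → ℝ → E k → E (n + 1)
  /-- dynamics of player `Y` -/
  g : E (m + 1) → ℝ → E l → E (m + 1)
  /-- first piece of the running cost -/
  ℓ₁ : E (n + 1) → E (m + 1) → ℝ → ℝ → E k → ℝ
  /-- second piece of the running cost -/
  ℓ₂ : E (n + 1) → E (m + 1) → ℝ → ℝ → E l → ℝ
  /-- discount factor -/
  lam : ℝ
  /-- bound for dynamics and costs -/
  M : ℝ
  /-- Lipschitz constant -/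
  L : ℝ
  hlam : 0 < lam
  hM : 0 < M
  hL : 0 < L
  hfCont : ∀ w : ℝ, w = 1 ∨ w = -1 →
    ContinuousOn (fun p : E (n + 1) × E k => f p.1 w p.2) (univ ×ˢ A)
  hgCont : ∀ z : ℝ, z = 1 ∨ z = -1 →
    ContinuousOn (fun p : E (m + 1) × E l => g p.1 z p.2) (univ ×ˢ B)
  hfBdd : ∀ x w a, a ∈ A → ‖f x w a‖ ≤ M
  hgBdd : ∀ y z b, b ∈ B → ‖g y z b‖ ≤ M
  hfLip : ∀ w a x₁ x₂, a ∈ A → ‖f x₁ w a - f x₂ w a‖ ≤ L * ‖x₁ - x₂‖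
  hgLip : ∀ z b y₁ y₂, b ∈ B → ‖g y₁ z b - g y₂ z b‖ ≤ L * ‖y₁ - y₂‖
  hℓ₁nn : ∀ x y w z a, 0 ≤ ℓ₁ x y w z a
  hℓ₂nn : ∀ x y w z b, 0 ≤ ℓ₂ x y w z b
  hℓ₁Bdd : ∀ x y w z a, ℓ₁ x y w z a ≤ M
  hℓ₂Bdd : ∀ x y w z b, ℓ₂ x y w z b ≤ M
  hℓ₁Cont : ∀ w z : ℝ, w = 1 ∨ w = -1 → z = 1 ∨ z = -1 →
    ContinuousOn (fun p : (E (n + 1) × E (m + 1)) × E k => ℓ₁ p.1.1 p.1.2 w z p.2)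
      (univ ×ˢ A)
  hℓ₂Cont : ∀ w z : ℝ, w = 1 ∨ w = -1 → z = 1 ∨ z = -1 →
    ContinuousOn (fun p : (E (n + 1) × E (m + 1)) × E l => ℓ₂ p.1.1 p.1.2 w z p.2)
      (univ ×ˢ B)
  hℓ₁Lip : ∀ w z a x₁ y₁ x₂ y₂, a ∈ A →
    |ℓ₁ x₁ y₁ w z a - ℓ₁ x₂ y₂ w z a| ≤ L * (‖x₁ - x₂‖ + ‖y₁ - y₂‖)
  hℓ₂Lip : ∀ w z b x₁ y₁ x₂ y₂, b ∈ B →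
    |ℓ₂ x₁ y₁ w z b - ℓ₂ x₂ y₂ w z b| ≤ L * (‖x₁ - x₂‖ + ‖y₁ - y₂‖)
  /-- controllability of player `X` at its switching thresholds -/
  hcontrX : ∀ w : ℝ, w = 1 ∨ w = -1 → ∀ x : E (n + 1),
    ((w = 1 ∧ x 0 = ρm) ∨ (w = -1 ∧ x 0 = ρp)) →
    ∃ a₁ ∈ A, ∃ a₂ ∈ A, f x w a₁ 0 < 0 ∧ 0 < f x w a₂ 0
  /-- controllability of player `Y` at its switching thresholds -/
  hcontrY : ∀ z : ℝ, z = 1 ∨ z = -1 → ∀ y : E (m + 1),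
    ((z = 1 ∧ y 0 = ηm) ∨ (z = -1 ∧ y 0 = ηp)) →
    ∃ b₁ ∈ B, ∃ b₂ ∈ B, g y z b₁ 0 < 0 ∧ 0 < g y z b₂ 0

namespace Setting

variable {n m k l : ℕ} (S : Setting n m k l)

/-- Non-anticipating strategies of the minimizing player `X`. -/
def Strat : Type := {γ : Ctrl S.B → Ctrl S.A // NAStrategy S.B S.A γ}

/-- Non-anticipating strategies of the maximizing player `Y`. -/
def Xi : Type := {ξ : Ctrl S.A → Ctrl S.B // NAStrategy S.A S.B ξ}

/-- The full running cost `ℓ = ℓ₁ + ℓ₂`. -/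
def runCost (x : E (n + 1)) (y : E (m + 1)) (w z : ℝ) (a : E k) (b : E l) : ℝ :=
  S.ℓ₁ x y w z a + S.ℓ₂ x y w z b

/-- The closed sector `Ω̄_X^w`. -/
def sectX (w : ℝ) : Set (E (n + 1)) :=
  {x | (w = 1 ∧ S.ρm ≤ x 0) ∨ (w = -1 ∧ x 0 ≤ S.ρp)}

/-- The closed sector `Ω̄_Y^z`. -/
def sectY (z : ℝ) : Set (E (m + 1)) :=
  {y | (z = 1 ∧ S.ηm ≤ y 0) ∨ (z = -1 ∧ y 0 ≤ S.ηp)}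

/-- The switching threshold (boundary) `∂Ω_X^w = {x : x₁ = ρ_{-w}}`. -/
def bdX (w : ℝ) : Set (E (n + 1)) :=
  {x | (w = 1 ∧ x 0 = S.ρm) ∨ (w = -1 ∧ x 0 = S.ρp)}

/-- The switching threshold (boundary) `∂Ω_Y^z = {y : y₁ = η_{-z}}`. -/
def bdY (z : ℝ) : Set (E (m + 1)) :=
  {y | (z = 1 ∧ y 0 = S.ηm) ∨ (z = -1 ∧ y 0 = S.ηp)}

/-- The interior of the sector `Ω̄_X^w`. -/
def intX (w : ℝ) : Set (E (n + 1)) :=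
  {x | (w = 1 ∧ S.ρm < x 0) ∨ (w = -1 ∧ x 0 < S.ρp)}

/-- The interior of the sector `Ω̄_Y^z`. -/
def intY (z : ℝ) : Set (E (m + 1)) :=
  {y | (z = 1 ∧ S.ηm < y 0) ∨ (z = -1 ∧ y 0 < S.ηp)}

/-- The pair of trajectory maps `(X, W)` of player `X` solves the thermostatic switching
system: `X` solves the integral equation driven by `f` and the switching variable `W`,
and `W` is the delayed-thermostat output of the first coordinate of `X`. -/
def IsSolX (solX : E (n + 1) → ℝ → Ctrl S.A → ℝ → E (n + 1))
    (solW : E (n + 1) → ℝ → Ctrl S.A → ℝ → ℝ) : Prop :=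
  ∀ (x : E (n + 1)) (w : ℝ) (α : Ctrl S.A), (w = 1 ∨ w = -1) →
    ((w = 1 ∧ S.ρm ≤ x 0) ∨ (w = -1 ∧ x 0 ≤ S.ρp)) →
    (∀ t : ℝ, 0 ≤ t →
      solX x w α t = x + ∫ s in (0 : ℝ)..t, S.f (solX x w α s) (solW x w α s) (α.1 s)) ∧
    IsThermostat S.ρm S.ρp (fun t => solX x w α t 0) w (solW x w α)

/-- The pair of trajectory maps `(Y, Z)` of player `Y` solves the thermostatic switching
system. -/
def IsSolY (solY : E (m + 1) → ℝ → Ctrl S.B → ℝ → E (m + 1))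
    (solZ : E (m + 1) → ℝ → Ctrl S.B → ℝ → ℝ) : Prop :=
  ∀ (y : E (m + 1)) (z : ℝ) (β : Ctrl S.B), (z = 1 ∨ z = -1) →
    ((z = 1 ∧ S.ηm ≤ y 0) ∨ (z = -1 ∧ y 0 ≤ S.ηp)) →
    (∀ t : ℝ, 0 ≤ t →
      solY y z β t = y + ∫ s in (0 : ℝ)..t, S.g (solY y z β s) (solZ y z β s) (β.1 s)) ∧
    IsThermostat S.ηm S.ηp (fun t => solY y z β t 0) z (solZ y z β)

/-- The infinite-horizon discounted cost of the switching game. -/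
def J (solX : E (n + 1) → ℝ → Ctrl S.A → ℝ → E (n + 1))
    (solW : E (n + 1) → ℝ → Ctrl S.A → ℝ → ℝ)
    (solY : E (m + 1) → ℝ → Ctrl S.B → ℝ → E (m + 1))
    (solZ : E (m + 1) → ℝ → Ctrl S.B → ℝ → ℝ)
    (x : E (n + 1)) (y : E (m + 1)) (w z : ℝ) (α : Ctrl S.A) (β : Ctrl S.B) : ℝ :=
  ∫ t in Ioi (0 : ℝ), Real.exp (-S.lam * t) *
    S.runCost (solX x w α t) (solY y z β t) (solW x w α t) (solZ y z β t) (α.1 t) (β.1 t)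

/-- The lower value function of the switching game. -/
def Vlow (solX : E (n + 1) → ℝ → Ctrl S.A → ℝ → E (n + 1))
    (solW : E (n + 1) → ℝ → Ctrl S.A → ℝ → ℝ)
    (solY : E (m + 1) → ℝ → Ctrl S.B → ℝ → E (m + 1))
    (solZ : E (m + 1) → ℝ → Ctrl S.B → ℝ → ℝ)
    (x : E (n + 1)) (y : E (m + 1)) (w z : ℝ) : ℝ :=
  ⨅ γ : S.Strat, ⨆ β : Ctrl S.B, S.J solX solW solY solZ x y w z (γ.1 β) β

/-- The upper value function of the switching game. -/
def Vup (solX : E (n + 1) → ℝ → Ctrl S.A → ℝ → E (n + 1))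
    (solW : E (n + 1) → ℝ → Ctrl S.A → ℝ → ℝ)
    (solY : E (m + 1) → ℝ → Ctrl S.B → ℝ → E (m + 1))
    (solZ : E (m + 1) → ℝ → Ctrl S.B → ℝ → ℝ)
    (x : E (n + 1)) (y : E (m + 1)) (w z : ℝ) : ℝ :=
  ⨆ ξ : S.Xi, ⨅ α : Ctrl S.A, S.J solX solW solY solZ x y w z α (ξ.1 α)

end Setting

end

/-- First exit time (valued in `ℝ≥0∞`) of the curve `ξ` from the set `S`. -/
noncomputable def exitTime {d : ℕ} (S : Set (E d)) (ξ : ℝ → E d) : ℝ≥0∞ :=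
  ⨅ t : {t : ℝ // 0 ≤ t ∧ ξ t ∉ S}, ENNReal.ofReal t.1

namespace Setting

variable {n m k l : ℕ} (S : Setting n m k l)

/-- Non-switching trajectory maps of player `X` with frozen switching label `w`:
`solXf w x α` solves `X' = f(X, w, α)`, `X(0) = x`. -/
def IsSolXf (solXf : ℝ → E (n + 1) → Ctrl S.A → ℝ → E (n + 1)) : Prop :=
  ∀ (w : ℝ) (x : E (n + 1)) (α : Ctrl S.A), (w = 1 ∨ w = -1) →
    ∀ t : ℝ, 0 ≤ t →
      solXf w x α t = x + ∫ s in (0 : ℝ)..t, S.f (solXf w x α s) w (α.1 s)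

/-- Non-switching trajectory maps of player `Y` with frozen switching label `z`. -/
def IsSolYf (solYf : ℝ → E (m + 1) → Ctrl S.B → ℝ → E (m + 1)) : Prop :=
  ∀ (z : ℝ) (y : E (m + 1)) (β : Ctrl S.B), (z = 1 ∨ z = -1) →
    ∀ t : ℝ, 0 ≤ t →
      solYf z y β t = y + ∫ s in (0 : ℝ)..t, S.g (solYf z y β s) z (β.1 s)

open Classical in
/-- The cost of the exit-time/exit-costs differential game on the sector `B̄_{(w,z)}`
with frozen dynamics `f(·,w,·)`, `g(·,z,·)`, running cost `ℓ(·,·,w,z,·,·)` and exit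
costs `ψX` (only `X` exits first), `ψY` (only `Y` exits first), `ψXY` (simultaneous
exit); no exit cost is paid if the trajectories never leave the sector. -/
noncomputable def Jexit
    (solXf : ℝ → E (n + 1) → Ctrl S.A → ℝ → E (n + 1))
    (solYf : ℝ → E (m + 1) → Ctrl S.B → ℝ → E (m + 1))
    (w z : ℝ) (ψX ψY ψXY : E (n + 1) → E (m + 1) → ℝ)
    (x : E (n + 1)) (y : E (m + 1)) (α : Ctrl S.A) (β : Ctrl S.B) : ℝ :=
  let X := solXf w x α
  let Y := solYf z y β
  let τx := exitTime (S.sectX w) X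
  let τy := exitTime (S.sectY z) Y
  let τ := min τx τy
  if τ = ⊤ then
    ∫ t in Ioi (0 : ℝ), Real.exp (-S.lam * t) * S.runCost (X t) (Y t) w z (α.1 t) (β.1 t)
  else
    (∫ t in Ioc (0 : ℝ) τ.toReal,
      Real.exp (-S.lam * t) * S.runCost (X t) (Y t) w z (α.1 t) (β.1 t)) +
      Real.exp (-S.lam * τ.toReal) *
        (if τx < τy then ψX (X τ.toReal) (Y τ.toReal)
         else if τy < τx then ψY (X τ.toReal) (Y τ.toReal)
         else ψXY (X τ.toReal) (Y τ.toReal))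

/-- The lower value of the exit-time/exit-costs differential game on the sector
`B̄_{(w,z)}` with exit costs `ψX`, `ψY`, `ψXY`. -/
noncomputable def Tval
    (solXf : ℝ → E (n + 1) → Ctrl S.A → ℝ → E (n + 1))
    (solYf : ℝ → E (m + 1) → Ctrl S.B → ℝ → E (m + 1))
    (w z : ℝ) (ψX ψY ψXY : E (n + 1) → E (m + 1) → ℝ)
    (x : E (n + 1)) (y : E (m + 1)) : ℝ :=
  ⨅ γ : S.Strat, ⨆ β : Ctrl S.B,
    S.Jexit solXf solYf w z ψX ψY ψXY x y (γ.1 β) β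

/-- The operator `T₁`: the exit costs are the values of `u` itself at the switched
labels. -/
noncomputable def T1
    (solXf : ℝ → E (n + 1) → Ctrl S.A → ℝ → E (n + 1))
    (solYf : ℝ → E (m + 1) → Ctrl S.B → ℝ → E (m + 1))
    (u : E (n + 1) → E (m + 1) → ℝ → ℝ → ℝ)
    (x : E (n + 1)) (y : E (m + 1)) (w z : ℝ) : ℝ :=
  S.Tval solXf solYf w z
    (fun x' y' => u x' y' (-w) z) (fun x' y' => u x' y' w (-z))
    (fun x' y' => u x' y' (-w) (-z)) x y

/-- The operator `T₂`: as `T₁`, but the exit costs for the single exits are the values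
of `T₁[u]`, while the simultaneous-exit cost is still `u(·,·,-w,-z)`. -/
noncomputable def T2
    (solXf : ℝ → E (n + 1) → Ctrl S.A → ℝ → E (n + 1))
    (solYf : ℝ → E (m + 1) → Ctrl S.B → ℝ → E (m + 1))
    (u : E (n + 1) → E (m + 1) → ℝ → ℝ → ℝ)
    (x : E (n + 1)) (y : E (m + 1)) (w z : ℝ) : ℝ :=
  S.Tval solXf solYf w z
    (fun x' y' => S.T1 solXf solYf u x' y' (-w) z)
    (fun x' y' => S.T1 solXf solYf u x' y' w (-z))
    (fun x' y' => u x' y' (-w) (-z)) x y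

/-- The operator `T₃`: as `T₂`, but with single-exit costs `T₂[u]` and
simultaneous-exit cost `T₁[u]`. -/
noncomputable def T3
    (solXf : ℝ → E (n + 1) → Ctrl S.A → ℝ → E (n + 1))
    (solYf : ℝ → E (m + 1) → Ctrl S.B → ℝ → E (m + 1))
    (u : E (n + 1) → E (m + 1) → ℝ → ℝ → ℝ)
    (x : E (n + 1)) (y : E (m + 1)) (w z : ℝ) : ℝ :=
  S.Tval solXf solYf w z
    (fun x' y' => S.T2 solXf solYf u x' y' (-w) z)
    (fun x' y' => S.T2 solXf solYf u x' y' w (-z))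
    (fun x' y' => S.T1 solXf solYf u x' y' (-w) (-z)) x y

/-- Membership in the set `C`: bounded, continuous in `(x,y)` on each sector, and
satisfying the corner compatibility inequalities. -/
def MemC (u : E (n + 1) → E (m + 1) → ℝ → ℝ → ℝ) : Prop :=
  (∃ Cb : ℝ, ∀ (w z : ℝ) (x : E (n + 1)) (y : E (m + 1)), |u x y w z| ≤ Cb) ∧
  (∀ w z : ℝ, w = 1 ∨ w = -1 → z = 1 ∨ z = -1 →
    ContinuousOn (fun p : E (n + 1) × E (m + 1) => u p.1 p.2 w z)
      (S.sectX w ×ˢ S.sectY z)) ∧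
  (∀ w z : ℝ, w = 1 ∨ w = -1 → z = 1 ∨ z = -1 →
    ∀ x ∈ S.bdX w, ∀ y ∈ S.bdY z,
      u x y w (-z) ≤ u x y (-w) (-z) ∧ u x y (-w) (-z) ≤ u x y (-w) z)

end Setting

namespace Setting

variable {n m k l : ℕ} (S : Setting n m k l)

/-- The set of admissible states `(x, y, w, z)` with `(w, z) ∈ {-1,1}²` and
`(x, y) ∈ B̄_{(w,z)}`. -/
def Adm : Set (E (n + 1) × E (m + 1) × ℝ × ℝ) :=
  {q | (q.2.2.1 = 1 ∨ q.2.2.1 = -1) ∧ (q.2.2.2 = 1 ∨ q.2.2.2 = -1) ∧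
    q.1 ∈ S.sectX q.2.2.1 ∧ q.2.1 ∈ S.sectY q.2.2.2}

/-- The sup norm over the union of the sectors `⋃_{(w,z)} B̄_{(w,z)} × {(w,z)}`. -/
noncomputable def supNorm (v : E (n + 1) → E (m + 1) → ℝ → ℝ → ℝ) : ℝ :=
  ⨆ q : S.Adm, |v q.1.1 q.1.2.1 q.1.2.2.1 q.1.2.2.2|

end Setting

/-- A curve satisfying the integral equation of a bounded controlled dynamics is Lipschitz on
`[0, ∞)`. Integrability of the integrand is not assumed: it is forced by the equation. -/
lemma norm_sub_le_of_integral_eq {d e : ℕ} {A : Set (E e)} {F : E d → E e → E d} {M : ℝ}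
    (hF : ContinuousOn (fun p : E d × E e => F p.1 p.2) (univ ×ˢ A))
    (hM : ∀ x a, a ∈ A → ‖F x a‖ ≤ M) (α : Ctrl A) {x : E d} {X : ℝ → E d}
    (hX : ∀ t : ℝ, 0 ≤ t → X t = x + ∫ s in (0 : ℝ)..t, F (X s) (α.1 s))
    {s t : ℝ} (hs : 0 ≤ s) (ht : 0 ≤ t) : ‖X t - X s‖ ≤ M * |t - s| := by
  set G : ℝ → E d := fun s => F (X s) (α.1 s)
  -- the times up to which the integrand is integrable
  set I : Set ℝ := {t | 0 ≤ t ∧ IntervalIntegrable G volume 0 t}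
  have hIoc : I.OrdConnected := by
    refine ⟨fun a ha b hb c hc => ⟨ha.1.trans hc.1, hb.2.mono_set ?_⟩⟩
    rw [uIcc_of_le (ha.1.trans hc.1), uIcc_of_le hb.1]
    exact Icc_subset_Icc_right hc.2
  have hcont : ContinuousOn X I := by
    intro a ha
    have h0 : ContinuousOn (fun b => x + ∫ s in (0 : ℝ)..b, G s) I := by
      refine continuousOn_const.add ?_
      intro b hb
      have hle : ∀ c ∈ I, ∀ c' ∈ I, dist (∫ s in (0 : ℝ)..c, G s) (∫ s in (0 : ℝ)..c', G s)
          ≤ M * |c - c'| := by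
        intro c hc c' hc'
        rw [dist_eq_norm, integral_interval_sub_left hc.2 hc'.2]
        exact norm_integral_le_of_norm_le_const fun s _ => hM _ _ (α.2.2 s)
      refine tendsto_iff_dist_tendsto_zero.2 (squeeze_zero' (.of_forall fun _ => dist_nonneg)
        (g := fun c => M * |c - b|) ?_ ?_)
      · filter_upwards [self_mem_nhdsWithin] with c hc using hle c hc b hb
      · have : Continuous fun c => M * |c - b| := by fun_prop
        simpa using (this.tendsto b).mono_left nhdsWithin_le_nhds
    exact (h0 a ha).congr (fun b hb => hX b hb.1) (hX a ha.1)
  have hXm : AEMeasurable X (volume.restrict (Ici 0)) := by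
    have h1 : AEMeasurable X (volume.restrict I) := hcont.aemeasurable hIoc.measurableSet
    have h2 : AEMeasurable X (volume.restrict (Ici 0 \ I)) := by
      refine (aemeasurable_const (b := x)).congr ?_
      refine (ae_restrict_iff' (measurableSet_Ici.diff hIoc.measurableSet)).2
        (.of_forall fun t ht => ?_)
      have : ¬ IntervalIntegrable G volume 0 t := fun h => ht.2 ⟨ht.1, h⟩
      rw [hX t ht.1, integral_undef this, add_zero]
    refine (aemeasurable_union_iff.2 ⟨h1, h2⟩).mono_measure (Measure.restrict_mono ?_ le_rfl)
    intro t ht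
    by_cases h : t ∈ I
    exacts [Or.inl h, Or.inr ⟨ht, h⟩]
  have hGm : AEStronglyMeasurable G (volume.restrict (Ici 0)) := by
    -- factor through the subtype of admissible controls, where the dynamics is continuous
    have hFc : Continuous fun p : E d × A => F p.1 p.2 := by
      refine hF.comp_continuous (f := fun p : E d × A => (p.1, (p.2 : E e))) (by fun_prop) ?_
      exact fun p => ⟨mem_univ _, p.2.2⟩
    have hαm : AEMeasurable (fun t => (⟨α.1 t, α.2.2 t⟩ : A)) (volume.restrict (Ici 0)) :=
      (α.2.1.subtype_mk).aemeasurable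
    exact (hFc.measurable.comp_aemeasurable (hXm.prodMk hαm)).aestronglyMeasurable
  have hint : ∀ t, 0 ≤ t → IntervalIntegrable G volume 0 t := by
    intro t ht
    rw [intervalIntegrable_iff_integrableOn_Ioc_of_le ht]
    refine Integrable.of_bound (hGm.mono_set fun s hs => hs.1.le) M ?_
    exact .of_forall fun s => hM _ _ (α.2.2 s)
  rw [hX t ht, hX s hs, add_sub_add_left_eq_sub, integral_interval_sub_left (hint t ht) (hint s hs)]
  exact norm_integral_le_of_norm_le_const fun s _ => hM _ _ (α.2.2 s)

/-- Up to its exit time from `{D ≥ 0}`, a Lipschitz curve stays in `{D ≥ 0}`. -/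
lemma nonneg_of_le_exitTime {d : ℕ} {U : Set (E d)} {D : E d → ℝ} {ξ : ℝ → E d} {M t : ℝ}
    (hM : 0 < M) (hU : ∀ x, x ∈ U ↔ 0 ≤ D x) (h0 : 0 ≤ D (ξ 0))
    (hD : ∀ s t, 0 ≤ s → 0 ≤ t → |D (ξ t) - D (ξ s)| ≤ M * |t - s|)
    (ht : 0 ≤ t) (hle : ENNReal.ofReal t ≤ exitTime U ξ) : 0 ≤ D (ξ t) := by
  by_contra! hneg
  have htpos : 0 < t := ht.lt_of_ne (by rintro rfl; linarith)
  -- an earlier time at which the curve is still outside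
  obtain ⟨s, hs0, hst, hs⟩ : ∃ s, 0 ≤ s ∧ s < t ∧ M * (t - s) < -D (ξ t) := by
    refine ⟨max 0 (t - -D (ξ t) / (2 * M)), le_max_left _ _, ?_, ?_⟩
    · have : 0 < -D (ξ t) / (2 * M) := by apply div_pos <;> linarith
      exact max_lt htpos (by linarith)
    · have h1 : t - max 0 (t - -D (ξ t) / (2 * M)) ≤ -D (ξ t) / (2 * M) := by
        linarith [le_max_right 0 (t - -D (ξ t) / (2 * M))]
      calc _ ≤ M * (-D (ξ t) / (2 * M)) := by gcongr
        _ = -D (ξ t) / 2 := by field_simp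
        _ < _ := by linarith
  have hsneg : D (ξ s) < 0 := by
    have := hD s t hs0 ht
    rw [abs_of_pos (sub_pos.2 hst)] at this
    linarith [(abs_le.1 this).1]
  have hexit : exitTime U ξ ≤ ENNReal.ofReal s :=
    iInf_le (fun t : {t : ℝ // 0 ≤ t ∧ ξ t ∉ U} => ENNReal.ofReal t.1)
      ⟨s, hs0, fun h => hsneg.not_ge ((hU _).1 h)⟩
  exact hst.not_ge ((ENNReal.ofReal_le_ofReal_iff hs0).1 (hle.trans hexit))

/-- At a finite exit time from `{D ≥ 0}`, a Lipschitz curve lies on `{D = 0}`. -/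
lemma eq_zero_at_exitTime {d : ℕ} {U : Set (E d)} {D : E d → ℝ} {ξ : ℝ → E d} {M : ℝ}
    (hM : 0 < M) (hU : ∀ x, x ∈ U ↔ 0 ≤ D x) (h0 : 0 ≤ D (ξ 0))
    (hD : ∀ s t, 0 ≤ s → 0 ≤ t → |D (ξ t) - D (ξ s)| ≤ M * |t - s|)
    (hfin : exitTime U ξ ≠ ⊤) : D (ξ (exitTime U ξ).toReal) = 0 := by
  set τ := exitTime U ξ with hτ
  have hτ0 : 0 ≤ τ.toReal := ENNReal.toReal_nonneg
  refine le_antisymm ?_ (nonneg_of_le_exitTime hM hU h0 hD hτ0 (ENNReal.ofReal_toReal hfin).le)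
  by_contra! hpos
  set ε := D (ξ τ.toReal) / M with hε
  have hεpos : 0 < ε := div_pos hpos hM
  have hlt : τ < ENNReal.ofReal (τ.toReal + ε) := by
    rw [← ENNReal.ofReal_toReal hfin, ENNReal.toReal_ofReal hτ0,
      ENNReal.ofReal_lt_ofReal_iff (by linarith)]
    linarith
  obtain ⟨⟨s, hs0, hs⟩, hsl⟩ := iInf_lt_iff.1 (hτ ▸ hlt)
  have hsl' : s < τ.toReal + ε := (ENNReal.ofReal_lt_ofReal_iff (by linarith)).1 hsl
  have hτs : τ.toReal ≤ s := by
    rw [← ENNReal.le_ofReal_iff_toReal_le hfin hs0]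
    exact iInf_le (fun t : {t : ℝ // 0 ≤ t ∧ ξ t ∉ U} => ENNReal.ofReal t.1) ⟨s, hs0, hs⟩
  have h := hD _ s hτ0 hs0
  rw [abs_of_nonneg (sub_nonneg.2 hτs)] at h
  have h2 : M * (s - τ.toReal) < D (ξ τ.toReal) := by
    calc _ < M * ε := by gcongr; linarith
      _ = _ := by rw [hε]; field_simp
  exact hs ((hU _).2 (by linarith [(abs_le.1 h).1]))

/-- The lower values of two uniformly bounded, uniformly close payoffs are close. -/
lemma abs_iInf_iSup_sub_le {ι κ : Type*} [Nonempty ι] [Nonempty κ] {F G : ι → κ → ℝ} {C ε : ℝ}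
    (hF : ∀ i j, |F i j| ≤ C) (hG : ∀ i j, |G i j| ≤ C) (h : ∀ i j, |F i j - G i j| ≤ ε) :
    |(⨅ i, ⨆ j, F i j) - ⨅ i, ⨆ j, G i j| ≤ ε := by
  have key : ∀ F G : ι → κ → ℝ, (∀ i j, |F i j| ≤ C) → (∀ i j, |G i j| ≤ C) →
      (∀ i j, |F i j - G i j| ≤ ε) → (⨅ i, ⨆ j, F i j) - ε ≤ ⨅ i, ⨆ j, G i j := by
    intro F G hF hG h
    have bF : ∀ i, BddAbove (range (F i)) := fun i =>
      ⟨C, by rintro _ ⟨j, rfl⟩; exact (abs_le.1 (hF i j)).2⟩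
    have bG : ∀ i, BddAbove (range (G i)) := fun i =>
      ⟨C, by rintro _ ⟨j, rfl⟩; exact (abs_le.1 (hG i j)).2⟩
    have bI : BddBelow (range fun i => ⨆ j, F i j) := by
      refine ⟨-C, ?_⟩
      rintro _ ⟨i, rfl⟩
      obtain ⟨j⟩ := ‹Nonempty κ›
      exact (abs_le.1 (hF i j)).1.trans (le_ciSup (bF i) j)
    refine le_ciInf fun i => ?_
    have h1 : (⨅ i, ⨆ j, F i j) ≤ ⨆ j, F i j := ciInf_le bI i
    have h2 : (⨆ j, F i j) ≤ (⨆ j, G i j) + ε := by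
      refine ciSup_le fun j => ?_
      have := (abs_le.1 (h i j)).2
      linarith [le_ciSup (bG i) j]
    linarith
  have h1 := key F G hF hG h
  have h2 := key G F hG hF fun i j => by rw [abs_sub_comm]; exact h i j
  rw [abs_le]
  constructor <;> linarith

lemma abs_iInf_iSup_le {ι κ : Type*} [Nonempty ι] [Nonempty κ] {F : ι → κ → ℝ} {C : ℝ}
    (hF : ∀ i j, |F i j| ≤ C) : |⨅ i, ⨆ j, F i j| ≤ C := by
  have hC : 0 ≤ C := by
    obtain ⟨i⟩ := ‹Nonempty ι›
    obtain ⟨j⟩ := ‹Nonempty κ›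
    exact (abs_nonneg _).trans (hF i j)
  simpa using abs_iInf_iSup_sub_le (G := fun _ _ => 0) hF (by simpa using hC) (by simpa using hF)

/-- Signed distance of `c` from the threshold at which a thermostat with thresholds `lo < hi` and
output `w` switches; it is nonnegative as long as no switch occurs. -/
noncomputable def depth (lo hi w c : ℝ) : ℝ := if w = 1 then c - lo else hi - c

lemma abs_depth_sub (lo hi w c c' : ℝ) : |depth lo hi w c - depth lo hi w c'| = |c - c'| := by
  unfold depth
  split_ifs
  · rw [sub_sub_sub_cancel_right]
  · rw [sub_sub_sub_cancel_left, abs_sub_comm]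

lemma depth_neg {w : ℝ} (hw : w = 1 ∨ w = -1) (lo hi c : ℝ) :
    depth lo hi (-w) c = hi - lo - depth lo hi w c := by
  rcases hw with rfl | rfl <;> norm_num [depth]

namespace Setting

variable {n m k l : ℕ} (S : Setting n m k l)

lemma mem_sectX_iff {w : ℝ} (hw : w = 1 ∨ w = -1) (x : E (n + 1)) :
    x ∈ S.sectX w ↔ 0 ≤ depth S.ρm S.ρp w (x 0) := by
  rcases hw with rfl | rfl <;> norm_num [sectX, depth]

lemma mem_sectY_iff {z : ℝ} (hz : z = 1 ∨ z = -1) (y : E (m + 1)) :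
    y ∈ S.sectY z ↔ 0 ≤ depth S.ηm S.ηp z (y 0) := by
  rcases hz with rfl | rfl <;> norm_num [sectY, depth]

instance : Nonempty (Ctrl S.A) :=
  ⟨⟨fun _ => S.hAne.some, measurable_const, fun _ => S.hAne.some_mem⟩⟩

instance : Nonempty (Ctrl S.B) :=
  ⟨⟨fun _ => S.hBne.some, measurable_const, fun _ => S.hBne.some_mem⟩⟩

instance : Nonempty S.Strat :=
  ⟨⟨fun _ => Classical.arbitrary _, fun _ _ _ _ _ => .of_forall fun _ => rfl⟩⟩

variable (solXf : ℝ → E (n + 1) → Ctrl S.A → ℝ → E (n + 1))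
  (solYf : ℝ → E (m + 1) → Ctrl S.B → ℝ → E (m + 1))

lemma depthX_lipschitz (hsolXf : S.IsSolXf solXf) {w : ℝ} (hw : w = 1 ∨ w = -1)
    (x : E (n + 1)) (α : Ctrl S.A) (s t : ℝ) (hs : 0 ≤ s) (ht : 0 ≤ t) :
    |depth S.ρm S.ρp w (solXf w x α t 0) - depth S.ρm S.ρp w (solXf w x α s 0)|
      ≤ S.M * |t - s| := by
  rw [abs_depth_sub]
  refine le_trans ?_ (norm_sub_le_of_integral_eq (S.hfCont w hw) (fun x a => S.hfBdd x w a) α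
    (hsolXf w x α hw) hs ht)
  simpa using PiLp.norm_apply_le (solXf w x α t - solXf w x α s) 0

lemma depthY_lipschitz (hsolYf : S.IsSolYf solYf) {z : ℝ} (hz : z = 1 ∨ z = -1)
    (y : E (m + 1)) (β : Ctrl S.B) (s t : ℝ) (hs : 0 ≤ s) (ht : 0 ≤ t) :
    |depth S.ηm S.ηp z (solYf z y β t 0) - depth S.ηm S.ηp z (solYf z y β s 0)|
      ≤ S.M * |t - s| := by
  rw [abs_depth_sub]
  refine le_trans ?_ (norm_sub_le_of_integral_eq (S.hgCont z hz) (fun y b => S.hgBdd y z b) β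
    (hsolYf z y β hz) hs ht)
  simpa using PiLp.norm_apply_le (solYf z y β t - solYf z y β s) 0

lemma abs_setIntegral_runCost_le {s : Set ℝ} (hs : s ⊆ Ioi 0) (w z : ℝ) (X : ℝ → E (n + 1))
    (Y : ℝ → E (m + 1)) (a : ℝ → E k) (b : ℝ → E l) :
    |∫ t in s, Real.exp (-S.lam * t) * S.runCost (X t) (Y t) w z (a t) (b t)|
      ≤ ∫ t in Ioi (0 : ℝ), Real.exp (-S.lam * t) * (2 * S.M) := by
  have hi : IntegrableOn (fun t : ℝ => Real.exp (-S.lam * t) * (2 * S.M)) (Ioi 0) :=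
    (integrableOn_exp_mul_Ioi (neg_lt_zero.2 S.hlam) 0).mul_const _
  have hM := S.hM
  rw [← Real.norm_eq_abs]
  refine le_trans
    (MeasureTheory.norm_integral_le_of_norm_le (hi.mono_set hs) (.of_forall fun t => ?_))
    (setIntegral_mono_set hi (.of_forall fun t => by positivity) hs.eventuallyLE)
  have h1 := S.hℓ₁nn (X t) (Y t) w z (a t)
  have h2 := S.hℓ₂nn (X t) (Y t) w z (b t)
  have h3 := S.hℓ₁Bdd (X t) (Y t) w z (a t)
  have h4 := S.hℓ₂Bdd (X t) (Y t) w z (b t)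
  rw [norm_mul, Real.norm_eq_abs, Real.abs_exp, runCost, Real.norm_of_nonneg (by linarith)]
  gcongr
  linarith

variable {w z : ℝ} {ψX ψY ψXY ψX' ψY' ψXY' : E (n + 1) → E (m + 1) → ℝ}

lemma abs_Jexit_le {C : ℝ} (hC : 0 ≤ C) (hX : ∀ x y, |ψX x y| ≤ C)
    (hY : ∀ x y, |ψY x y| ≤ C) (hXY : ∀ x y, |ψXY x y| ≤ C) (x : E (n + 1)) (y : E (m + 1))
    (α : Ctrl S.A) (β : Ctrl S.B) :
    |S.Jexit solXf solYf w z ψX ψY ψXY x y α β|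
      ≤ (∫ t in Ioi (0 : ℝ), Real.exp (-S.lam * t) * (2 * S.M)) + C := by
  unfold Jexit
  extract_lets X Y τx τy τ
  split_ifs with h
  · exact (S.abs_setIntegral_runCost_le subset_rfl ..).trans (le_add_of_nonneg_right hC)
  all_goals
    refine (abs_add_le _ _).trans (add_le_add
      (S.abs_setIntegral_runCost_le (fun t ht => ht.1) ..) ?_)
    rw [abs_mul, Real.abs_exp]
    refine (mul_le_of_le_one_left (abs_nonneg _) (Real.exp_le_one_iff.2 ?_)).trans ?_
    · nlinarith [S.hlam, ENNReal.toReal_nonneg (a := τ)]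
    · first | exact hX _ _ | exact hY _ _ | exact hXY _ _

lemma abs_Tval_le {C : ℝ} (hC : 0 ≤ C) (hX : ∀ x y, |ψX x y| ≤ C)
    (hY : ∀ x y, |ψY x y| ≤ C) (hXY : ∀ x y, |ψXY x y| ≤ C) (x : E (n + 1)) (y : E (m + 1)) :
    |S.Tval solXf solYf w z ψX ψY ψXY x y|
      ≤ (∫ t in Ioi (0 : ℝ), Real.exp (-S.lam * t) * (2 * S.M)) + C :=
  abs_iInf_iSup_le fun _ _ => S.abs_Jexit_le solXf solYf hC hX hY hXY ..

/-- Two exit costs are `δ`-close up to the discount `exp (-λ (c - t))` at all points of the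
sector which can be reached from `(x, y)` in time `t` and at which the exit condition `P` holds. -/
def CloseAtExit (w z : ℝ) (P : ℝ → ℝ → Prop) (c δ : ℝ) (x : E (n + 1)) (y : E (m + 1))
    (ψ ψ' : E (n + 1) → E (m + 1) → ℝ) : Prop :=
  ∀ t x' y', 0 ≤ t → 0 ≤ depth S.ρm S.ρp w (x' 0) → 0 ≤ depth S.ηm S.ηp z (y' 0) →
    depth S.ρm S.ρp w (x 0) ≤ depth S.ρm S.ρp w (x' 0) + S.M * t →
    depth S.ηm S.ηp z (y 0) ≤ depth S.ηm S.ηp z (y' 0) + S.M * t →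
    P (depth S.ρm S.ρp w (x' 0)) (depth S.ηm S.ηp z (y' 0)) →
    |ψ x' y' - ψ' x' y'| ≤ Real.exp (-S.lam * (c - t)) * δ

variable {c δ : ℝ} {x : E (n + 1)} {y : E (m + 1)}

variable {solXf solYf} in
lemma abs_Jexit_sub_le (hsolXf : S.IsSolXf solXf) (hsolYf : S.IsSolYf solYf)
    (hw : w = 1 ∨ w = -1) (hz : z = 1 ∨ z = -1) (hδ : 0 ≤ δ)
    (hx : 0 ≤ depth S.ρm S.ρp w (x 0)) (hy : 0 ≤ depth S.ηm S.ηp z (y 0))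
    (hX : S.CloseAtExit w z (fun a _ => a = 0) c δ x y ψX ψX')
    (hY : S.CloseAtExit w z (fun _ b => b = 0) c δ x y ψY ψY')
    (hXY : S.CloseAtExit w z (fun a b => a = 0 ∧ b = 0) c δ x y ψXY ψXY')
    (α : Ctrl S.A) (β : Ctrl S.B) :
    |S.Jexit solXf solYf w z ψX ψY ψXY x y α β - S.Jexit solXf solYf w z ψX' ψY' ψXY' x y α β|
      ≤ Real.exp (-S.lam * c) * δ := by
  unfold Jexit
  extract_lets X Y τx τy τ
  have hX0 : X 0 = x := by simpa using hsolXf w x α hw 0 le_rfl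
  have hY0 : Y 0 = y := by simpa using hsolYf z y β hz 0 le_rfl
  have lipX := S.depthX_lipschitz solXf hsolXf hw x α
  have lipY := S.depthY_lipschitz solYf hsolYf hz y β
  by_cases hτ : τ = ⊤
  · simp only [if_pos hτ, sub_self, abs_zero]
    positivity
  have hτ0 : 0 ≤ τ.toReal := ENNReal.toReal_nonneg
  have hinX : 0 ≤ depth S.ρm S.ρp w (X τ.toReal 0) :=
    nonneg_of_le_exitTime (D := fun x => depth S.ρm S.ρp w (x 0)) S.hM (S.mem_sectX_iff hw)
      (by simpa [X, hX0] using hx) lipX hτ0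
      ((ENNReal.ofReal_toReal hτ).le.trans (min_le_left _ _))
  have hinY : 0 ≤ depth S.ηm S.ηp z (Y τ.toReal 0) :=
    nonneg_of_le_exitTime (D := fun y => depth S.ηm S.ηp z (y 0)) S.hM (S.mem_sectY_iff hz)
      (by simpa [Y, hY0] using hy) lipY hτ0
      ((ENNReal.ofReal_toReal hτ).le.trans (min_le_right _ _))
  have hbdX : τ = τx → depth S.ρm S.ρp w (X τ.toReal 0) = 0 := fun h => by
    rw [h]
    exact eq_zero_at_exitTime (D := fun x => depth S.ρm S.ρp w (x 0)) S.hM (S.mem_sectX_iff hw)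
      (by simpa [X, hX0] using hx) lipX (fun h' => hτ (h.trans h'))
  have hbdY : τ = τy → depth S.ηm S.ηp z (Y τ.toReal 0) = 0 := fun h => by
    rw [h]
    exact eq_zero_at_exitTime (D := fun y => depth S.ηm S.ηp z (y 0)) S.hM (S.mem_sectY_iff hz)
      (by simpa [Y, hY0] using hy) lipY (fun h' => hτ (h.trans h'))
  have hrX : depth S.ρm S.ρp w (x 0) ≤ depth S.ρm S.ρp w (X τ.toReal 0) + S.M * τ.toReal := by
    have := (abs_le.1 (lipX 0 τ.toReal le_rfl hτ0)).1
    rw [sub_zero, abs_of_nonneg hτ0] at this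
    change _ ≤ depth S.ρm S.ρp w (X τ.toReal 0) - depth S.ρm S.ρp w (X 0 0) at this
    rw [hX0] at this
    linarith
  have hrY : depth S.ηm S.ηp z (y 0) ≤ depth S.ηm S.ηp z (Y τ.toReal 0) + S.M * τ.toReal := by
    have := (abs_le.1 (lipY 0 τ.toReal le_rfl hτ0)).1
    rw [sub_zero, abs_of_nonneg hτ0] at this
    change _ ≤ depth S.ηm S.ηp z (Y τ.toReal 0) - depth S.ηm S.ηp z (Y 0 0) at this
    rw [hY0] at this
    linarith
  have hexp : Real.exp (-S.lam * c) * δ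
      = Real.exp (-S.lam * τ.toReal) * (Real.exp (-S.lam * (c - τ.toReal)) * δ) := by
    rw [← mul_assoc, ← Real.exp_add]
    ring_nf
  rw [if_neg hτ, if_neg hτ, add_sub_add_left_eq_sub, ← mul_sub, abs_mul, Real.abs_exp, hexp]
  gcongr
  split_ifs with h1 h2
  · exact hX _ _ _ hτ0 hinX hinY hrX hrY (hbdX (min_eq_left h1.le))
  · exact hY _ _ _ hτ0 hinX hinY hrX hrY (hbdY (min_eq_right h2.le))
  · exact hXY _ _ _ hτ0 hinX hinY hrX hrY
      ⟨hbdX (min_eq_left (not_lt.1 h2)), hbdY (min_eq_right (not_lt.1 h1))⟩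

variable {solXf solYf} in
lemma abs_Tval_sub_le (hsolXf : S.IsSolXf solXf) (hsolYf : S.IsSolYf solYf)
    (hw : w = 1 ∨ w = -1) (hz : z = 1 ∨ z = -1) (hδ : 0 ≤ δ)
    (hx : 0 ≤ depth S.ρm S.ρp w (x 0)) (hy : 0 ≤ depth S.ηm S.ηp z (y 0)) {C : ℝ}
    (hC : ∀ x y, |ψX x y| ≤ C ∧ |ψY x y| ≤ C ∧ |ψXY x y| ≤ C)
    (hC' : ∀ x y, |ψX' x y| ≤ C ∧ |ψY' x y| ≤ C ∧ |ψXY' x y| ≤ C)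
    (hX : S.CloseAtExit w z (fun a _ => a = 0) c δ x y ψX ψX')
    (hY : S.CloseAtExit w z (fun _ b => b = 0) c δ x y ψY ψY')
    (hXY : S.CloseAtExit w z (fun a b => a = 0 ∧ b = 0) c δ x y ψXY ψXY') :
    |S.Tval solXf solYf w z ψX ψY ψXY x y - S.Tval solXf solYf w z ψX' ψY' ψXY' x y|
      ≤ Real.exp (-S.lam * c) * δ := by
  have hC0 : 0 ≤ C := (abs_nonneg _).trans (hC 0 0).1
  exact abs_iInf_iSup_sub_le
    (fun _ _ => S.abs_Jexit_le solXf solYf hC0 (fun x y => (hC x y).1) (fun x y => (hC x y).2.1)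
      (fun x y => (hC x y).2.2) ..)
    (fun _ _ => S.abs_Jexit_le solXf solYf hC0 (fun x y => (hC' x y).1) (fun x y => (hC' x y).2.1)
      (fun x y => (hC' x y).2.2) ..)
    fun _ _ => S.abs_Jexit_sub_le hsolXf hsolYf hw hz hδ hx hy hX hY hXY ..

variable {u u₁ u₂ : E (n + 1) → E (m + 1) → ℝ → ℝ → ℝ} {C : ℝ}

lemma abs_T1_le (hu : ∀ x y w z, |u x y w z| ≤ C) (x : E (n + 1)) (y : E (m + 1)) (w z : ℝ) :
    |S.T1 solXf solYf u x y w z|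
      ≤ (∫ t in Ioi (0 : ℝ), Real.exp (-S.lam * t) * (2 * S.M)) + C :=
  S.abs_Tval_le solXf solYf ((abs_nonneg _).trans (hu 0 0 0 0)) (fun _ _ => hu ..)
    (fun _ _ => hu ..) (fun _ _ => hu ..) x y

lemma integral_discount_nonneg : 0 ≤ ∫ t in Ioi (0 : ℝ), Real.exp (-S.lam * t) * (2 * S.M) :=
  integral_nonneg fun t => by have := S.hM; positivity

lemma abs_T2_le (hu : ∀ x y w z, |u x y w z| ≤ C) (x : E (n + 1)) (y : E (m + 1)) (w z : ℝ) :
    |S.T2 solXf solYf u x y w z|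
      ≤ (∫ t in Ioi (0 : ℝ), Real.exp (-S.lam * t) * (2 * S.M)) +
        ((∫ t in Ioi (0 : ℝ), Real.exp (-S.lam * t) * (2 * S.M)) + C) :=
  S.abs_Tval_le solXf solYf ((abs_nonneg _).trans (S.abs_T1_le solXf solYf hu 0 0 0 0))
    (fun _ _ => S.abs_T1_le solXf solYf hu ..) (fun _ _ => S.abs_T1_le solXf solYf hu ..)
    (fun _ _ => (hu ..).trans (le_add_of_nonneg_left S.integral_discount_nonneg)) x y

/-- `u₁` and `u₂` are `δ`-close on the union of the sectors. -/
def CloseOn (δ : ℝ) (u₁ u₂ : E (n + 1) → E (m + 1) → ℝ → ℝ → ℝ) : Prop :=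
  ∀ w z x y, (w = 1 ∨ w = -1) → (z = 1 ∨ z = -1) → 0 ≤ depth S.ρm S.ρp w (x 0) →
    0 ≤ depth S.ηm S.ηp z (y 0) → |u₁ x y w z - u₂ x y w z| ≤ δ

lemma neg_label {w : ℝ} (hw : w = 1 ∨ w = -1) : -w = 1 ∨ -w = -1 := by
  rcases hw with rfl | rfl <;> simp

lemma le_exp_mul_of_le (hδ : 0 ≤ δ) {t : ℝ} (h : S.M * c ≤ S.M * t) :
    δ ≤ Real.exp (-S.lam * (c - t)) * δ := by
  have := le_of_mul_le_mul_left h S.hM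
  refine le_mul_of_one_le_left hδ (Real.one_le_exp ?_)
  nlinarith [S.hlam]

variable {solXf solYf} in
/-- If neither player can switch before time `c`, then `T₁` contracts by `exp (-λ c)`. -/
lemma abs_T1_sub_le (hsolXf : S.IsSolXf solXf) (hsolYf : S.IsSolYf solYf)
    (hu₁ : ∀ x y w z, |u₁ x y w z| ≤ C) (hu₂ : ∀ x y w z, |u₂ x y w z| ≤ C)
    (hδ : 0 ≤ δ) (hu : S.CloseOn δ u₁ u₂) (hw : w = 1 ∨ w = -1) (hz : z = 1 ∨ z = -1)
    (hx : 0 ≤ depth S.ρm S.ρp w (x 0)) (hy : 0 ≤ depth S.ηm S.ηp z (y 0))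
    (hcx : S.M * c ≤ depth S.ρm S.ρp w (x 0)) (hcy : S.M * c ≤ depth S.ηm S.ηp z (y 0)) :
    |S.T1 solXf solYf u₁ x y w z - S.T1 solXf solYf u₂ x y w z| ≤ Real.exp (-S.lam * c) * δ := by
  have hρ := S.hρ
  have hη := S.hη
  refine S.abs_Tval_sub_le hsolXf hsolYf hw hz hδ hx hy
    (fun _ _ => ⟨hu₁ .., hu₁ .., hu₁ ..⟩) (fun _ _ => ⟨hu₂ .., hu₂ .., hu₂ ..⟩) ?_ ?_ ?_
  · intro t x' y' ht hx' hy' hrx hry h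
    refine (hu _ _ _ _ (neg_label hw) hz ?_ hy').trans (S.le_exp_mul_of_le hδ (by linarith))
    rw [depth_neg hw]; linarith
  · intro t x' y' ht hx' hy' hrx hry h
    refine (hu _ _ _ _ hw (neg_label hz) hx' ?_).trans (S.le_exp_mul_of_le hδ (by linarith))
    rw [depth_neg hz]; linarith
  · intro t x' y' ht hx' hy' hrx hry h
    refine (hu _ _ _ _ (neg_label hw) (neg_label hz) ?_ ?_).trans
      (S.le_exp_mul_of_le hδ (by linarith))
    · rw [depth_neg hw]; linarith
    · rw [depth_neg hz]; linarith

variable {solXf solYf} in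
/-- If one of the players cannot switch before time `c`, and if `c` is at most the time the other
player needs to cross its thermostat band, then `T₂` contracts by `exp (-λ c)`. -/
lemma abs_T2_sub_le (hsolXf : S.IsSolXf solXf) (hsolYf : S.IsSolYf solYf)
    (hu₁ : ∀ x y w z, |u₁ x y w z| ≤ C) (hu₂ : ∀ x y w z, |u₂ x y w z| ≤ C)
    (hδ : 0 ≤ δ) (hu : S.CloseOn δ u₁ u₂) (hw : w = 1 ∨ w = -1) (hz : z = 1 ∨ z = -1)
    (hx : 0 ≤ depth S.ρm S.ρp w (x 0)) (hy : 0 ≤ depth S.ηm S.ηp z (y 0))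
    (hc : (S.M * c ≤ depth S.ρm S.ρp w (x 0) ∧ S.M * c ≤ S.ηp - S.ηm) ∨
      (S.M * c ≤ S.ρp - S.ρm ∧ S.M * c ≤ depth S.ηm S.ηp z (y 0))) :
    |S.T2 solXf solYf u₁ x y w z - S.T2 solXf solYf u₂ x y w z| ≤ Real.exp (-S.lam * c) * δ := by
  have hρ := S.hρ
  have hη := S.hη
  have hI := S.integral_discount_nonneg
  refine S.abs_Tval_sub_le hsolXf hsolYf hw hz hδ hx hy
    (fun _ _ => ⟨S.abs_T1_le solXf solYf hu₁ .., S.abs_T1_le solXf solYf hu₁ ..,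
      (hu₁ ..).trans (le_add_of_nonneg_left hI)⟩)
    (fun _ _ => ⟨S.abs_T1_le solXf solYf hu₂ .., S.abs_T1_le solXf solYf hu₂ ..,
      (hu₂ ..).trans (le_add_of_nonneg_left hI)⟩) ?_ ?_ ?_
  · intro t x' y' ht hx' hy' hrx hry h
    have hMt := mul_nonneg S.hM.le ht
    have hd := depth_neg hw S.ρm S.ρp (x' 0)
    refine S.abs_T1_sub_le hsolXf hsolYf hu₁ hu₂ hδ hu (neg_label hw) hz (by linarith) hy' ?_ ?_
    all_goals rw [mul_sub]; rcases hc with hc | hc <;> linarith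
  · intro t x' y' ht hx' hy' hrx hry h
    have hMt := mul_nonneg S.hM.le ht
    have hd := depth_neg hz S.ηm S.ηp (y' 0)
    refine S.abs_T1_sub_le hsolXf hsolYf hu₁ hu₂ hδ hu hw (neg_label hz) hx' (by linarith) ?_ ?_
    all_goals rw [mul_sub]; rcases hc with hc | hc <;> linarith
  · intro t x' y' ht hx' hy' hrx hry h
    refine (hu _ _ _ _ (neg_label hw) (neg_label hz) ?_ ?_).trans
      (S.le_exp_mul_of_le hδ (by rcases hc with hc | hc <;> linarith))
    · rw [depth_neg hw]; linarith
    · rw [depth_neg hz]; linarith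

variable {solXf solYf} in
/-- If `c` is at most the time needed to cross either thermostat band, then `T₃` contracts by
`exp (-λ c)`. -/
lemma abs_T3_sub_le (hsolXf : S.IsSolXf solXf) (hsolYf : S.IsSolYf solYf)
    (hu₁ : ∀ x y w z, |u₁ x y w z| ≤ C) (hu₂ : ∀ x y w z, |u₂ x y w z| ≤ C)
    (hδ : 0 ≤ δ) (hu : S.CloseOn δ u₁ u₂) (hw : w = 1 ∨ w = -1) (hz : z = 1 ∨ z = -1)
    (hx : 0 ≤ depth S.ρm S.ρp w (x 0)) (hy : 0 ≤ depth S.ηm S.ηp z (y 0))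
    (hcρ : S.M * c ≤ S.ρp - S.ρm) (hcη : S.M * c ≤ S.ηp - S.ηm) :
    |S.T3 solXf solYf u₁ x y w z - S.T3 solXf solYf u₂ x y w z| ≤ Real.exp (-S.lam * c) * δ := by
  have hρ := S.hρ
  have hη := S.hη
  have hI := S.integral_discount_nonneg
  refine S.abs_Tval_sub_le hsolXf hsolYf hw hz hδ hx hy
    (fun _ _ => ⟨S.abs_T2_le solXf solYf hu₁ .., S.abs_T2_le solXf solYf hu₁ ..,
      (S.abs_T1_le solXf solYf hu₁ ..).trans (le_add_of_nonneg_left hI)⟩)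
    (fun _ _ => ⟨S.abs_T2_le solXf solYf hu₂ .., S.abs_T2_le solXf solYf hu₂ ..,
      (S.abs_T1_le solXf solYf hu₂ ..).trans (le_add_of_nonneg_left hI)⟩) ?_ ?_ ?_
  · intro t x' y' ht hx' hy' hrx hry h
    have hMt := mul_nonneg S.hM.le ht
    have hd := depth_neg hw S.ρm S.ρp (x' 0)
    refine S.abs_T2_sub_le hsolXf hsolYf hu₁ hu₂ hδ hu (neg_label hw) hz (by linarith) hy'
      (Or.inl ?_)
    rw [mul_sub]
    constructor <;> linarith
  · intro t x' y' ht hx' hy' hrx hry h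
    have hMt := mul_nonneg S.hM.le ht
    have hd := depth_neg hz S.ηm S.ηp (y' 0)
    refine S.abs_T2_sub_le hsolXf hsolYf hu₁ hu₂ hδ hu hw (neg_label hz) hx' (by linarith)
      (Or.inr ?_)
    rw [mul_sub]
    constructor <;> linarith
  · intro t x' y' ht hx' hy' hrx hry h
    have hMt := mul_nonneg S.hM.le ht
    have hd := depth_neg hw S.ρm S.ρp (x' 0)
    have hd' := depth_neg hz S.ηm S.ηp (y' 0)
    refine S.abs_T1_sub_le hsolXf hsolYf hu₁ hu₂ hδ hu (neg_label hw) (neg_label hz)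
      (by linarith) (by linarith) ?_ ?_
    all_goals rw [mul_sub]; linarith

end Setting

/-- **The operator `T₃` is a contraction**: under the Main Assumptions and the
controllability condition, with
`h = min{(ρ₁ - ρ₋₁)/M, (η₁ - η₋₁)/M} > 0`, for all `u¹, u² ∈ C` one has
`‖T₃[u¹] - T₃[u²]‖_∞ ≤ e^{-λ h} ‖u¹ - u²‖_∞` in the sup norm over
`⋃_{(w,z)} B̄_{(w,z)} × {(w,z)}`. -/
theorem T3_contraction {n m k l : ℕ} (S : Setting n m k l)
    (solXf : ℝ → E (n + 1) → Ctrl S.A → ℝ → E (n + 1))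
    (solYf : ℝ → E (m + 1) → Ctrl S.B → ℝ → E (m + 1))
    (hsolXf : S.IsSolXf solXf) (hsolYf : S.IsSolYf solYf) :
    ∀ u₁ u₂ : E (n + 1) → E (m + 1) → ℝ → ℝ → ℝ, S.MemC u₁ → S.MemC u₂ →
      S.supNorm (fun x y w z =>
          S.T3 solXf solYf u₁ x y w z - S.T3 solXf solYf u₂ x y w z) ≤
        Real.exp (-S.lam * min ((S.ρp - S.ρm) / S.M) ((S.ηp - S.ηm) / S.M)) *
          S.supNorm (fun x y w z => u₁ x y w z - u₂ x y w z) := by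
  intro u₁ u₂ hu₁ hu₂
  obtain ⟨⟨C₁, hC₁⟩, -, -⟩ := hu₁
  obtain ⟨⟨C₂, hC₂⟩, -, -⟩ := hu₂
  set δ := S.supNorm (fun x y w z => u₁ x y w z - u₂ x y w z)
  have hδ0 : 0 ≤ δ := Real.iSup_nonneg fun _ => abs_nonneg _
  have hclose : S.CloseOn δ u₁ u₂ := by
    intro w z x y hw hz hx hy
    have hb : BddAbove (range fun q : S.Adm =>
        |u₁ q.1.1 q.1.2.1 q.1.2.2.1 q.1.2.2.2 - u₂ q.1.1 q.1.2.1 q.1.2.2.1 q.1.2.2.2|) := by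
      refine ⟨C₁ + C₂, ?_⟩
      rintro _ ⟨q, rfl⟩
      exact (abs_sub _ _).trans (add_le_add (hC₁ ..) (hC₂ ..))
    exact le_ciSup hb ⟨(x, y, w, z), hw, hz, (S.mem_sectX_iff hw x).2 hx,
      (S.mem_sectY_iff hz y).2 hy⟩
  refine Real.iSup_le ?_ (by positivity)
  rintro ⟨⟨x, y, w, z⟩, hw, hz, hx, hy⟩
  refine S.abs_T3_sub_le (C := max C₁ C₂) hsolXf hsolYf
    (fun _ _ _ _ => (hC₁ ..).trans (le_max_left _ _))
    (fun _ _ _ _ => (hC₂ ..).trans (le_max_right _ _)) hδ0 hclose hw hz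
    ((S.mem_sectX_iff hw x).1 hx) ((S.mem_sectY_iff hz y).1 hy) ?_ ?_
  · rw [mul_comm, ← le_div_iff₀ S.hM]
    exact min_le_left _ _
  · rw [mul_comm, ← le_div_iff₀ S.hM]
    exact min_le_right _ _
end
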